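/- arXiv:2507.16756 — 3 statements merged into one kernel-verified Lean document; each statement's English description precedes it below -/
import Mathlib

section
/- Let m ≥ 1, let Ω = ℕ → {1,…,m} with the product σ-algebra and coordinate maps X_i(ω) = ω(i), let T : Ω → Ω be the left shift (Tω)(i) = ω(i+1), and let μ be a T-invariant ergodic probability measure on Ω. Let P₀ be an m×m row-stochastic matrix with all entries strictly positive such that μ is Markov with transition matrix P₀: for every i ≥ 0, every w ∈ {1,…,m}^{i+1}, and every q, μ({ω : ω(j) = w(j) for j ≤ i, and ω(i+1) = q}) = P₀(w(i), q) · μ({ω : ω(j) = w(j) for j ≤ i}). Define the ℝ^{m×m}-valued score vectors V_i with coordinates V_i(p,q) = 1{X_{i−1}=p, X_i=q}/P₀(p,q) − 1{X_{i−1}=p}, and let Σ be the m²×m² covariance matrix Σ = E_μ[V₁ V₁ᵀ]. Then the law (pushforward under μ) of n^{−1/2} Σ_{i=1}^n V_i converges weakly, as n → ∞, to the centered multivariate Gaussian measure on ℝ^{m×m} with covariance matrix Σ. -/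
open MeasureTheory ProbabilityTheory Matrix Finset Filter

/-- A harmonic function of a strictly positive row-stochastic matrix is constant. -/
lemma harmonic_eq_of_pos {m : ℕ} {P : Matrix (Fin m) (Fin m) ℝ} (hpos : ∀ p q, 0 < P p q)
    (hrow : ∀ p, ∑ q, P p q = 1) {u : Fin m → ℝ} (hu : ∀ p, u p = ∑ q, P p q * u q)
    (p q : Fin m) : u p = u q := by
  have : Nonempty (Fin m) := ⟨p⟩
  obtain ⟨z, hz⟩ := Finite.exists_max u
  have key : ∑ q, P z q * (u z - u q) = 0 := by
    simp_rw [mul_sub, Finset.sum_sub_distrib, ← Finset.sum_mul, hrow, one_mul, ← hu, sub_self]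
  rw [Finset.sum_eq_zero_iff_of_nonneg
    fun q _ => mul_nonneg (hpos z q).le (sub_nonneg.2 (hz q))] at key
  have h (r : Fin m) : u r = u z := by
    rcases mul_eq_zero.1 (key r (Finset.mem_univ r)) with h | h
    · exact absurd h (hpos z r).ne'
    · linarith
  rw [h p, h q]

/-- Solvability of the Poisson equation of a finite chain with positive transition matrix. -/
lemma exists_poisson_solution {m : ℕ} {P : Matrix (Fin m) (Fin m) ℝ} (hpos : ∀ p q, 0 < P p q)
    (hrow : ∀ p, ∑ q, P p q = 1) {ρ : Fin m → ℝ} (hρ : ∑ p, ρ p = 1)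
    (hstat : ∀ q, ∑ p, ρ p * P p q = ρ q) {f : Fin m → ℝ} (hf : ∑ p, ρ p * f p = 0) :
    ∃ u : Fin m → ℝ, ∀ p, u p - ∑ q, P p q * u q = f p := by
  have hmean (u : Fin m → ℝ) : ∑ p, ρ p * ∑ q, P p q * u q = ∑ q, ρ q * u q := by
    simp_rw [Finset.mul_sum]
    rw [Finset.sum_comm]
    simp_rw [← mul_assoc, ← Finset.sum_mul, hstat]
  let B : (Fin m → ℝ) →ₗ[ℝ] (Fin m → ℝ) :=
    { toFun := fun u p => u p - ∑ q, P p q * u q + ∑ q, ρ q * u q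
      map_add' := fun u v => by
        ext p; simp only [Pi.add_apply, mul_add, Finset.sum_add_distrib]; ring
      map_smul' := fun c u => by
        ext p
        simp only [Pi.smul_apply, smul_eq_mul, RingHom.id_apply, mul_add, mul_sub, Finset.mul_sum,
          mul_left_comm] }
  have hB (u : Fin m → ℝ) (p : Fin m) : B u p = u p - ∑ q, P p q * u q + ∑ q, ρ q * u q := rfl
  have hBmean (u : Fin m → ℝ) : ∑ p, ρ p * B u p = ∑ q, ρ q * u q := by
    simp_rw [hB, mul_add, mul_sub, Finset.sum_add_distrib, Finset.sum_sub_distrib, hmean,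
      ← Finset.sum_mul, hρ]
    ring
  have hinj : Function.Injective B := by
    rw [← LinearMap.ker_eq_bot, LinearMap.ker_eq_bot']
    intro u hu
    have h0 : ∑ q, ρ q * u q = 0 := by rw [← hBmean, hu]; simp
    have hharm (p : Fin m) : u p = ∑ q, P p q * u q := by
      have := congrFun hu p
      rw [hB, h0] at this
      simpa [sub_eq_zero] using this
    ext p
    have : ∑ q, ρ q * u q = u p := by
      simp_rw [harmonic_eq_of_pos hpos hrow hharm _ p, ← Finset.sum_mul, hρ, one_mul]
    rw [← this, h0]; rfl
  obtain ⟨u, hu⟩ := (LinearMap.injective_iff_surjective.1 hinj) f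
  refine ⟨u, fun p => ?_⟩
  have h0 : ∑ q, ρ q * u q = 0 := by rw [← hBmean, hu, hf]
  have := congrFun hu p
  rw [hB, h0, add_zero] at this
  exact this

/-- One step of the Markov property, in integrated form. -/
lemma integral_markov_step {m : ℕ} {μ : Measure (ℕ → Fin m)} [IsProbabilityMeasure μ]
    {P : Matrix (Fin m) (Fin m) ℝ} (hpos : ∀ p q, 0 < P p q)
    (hMarkov : ∀ (i : ℕ) (w : ℕ → Fin m) (q : Fin m),
      μ {ω | (∀ j ≤ i, ω j = w j) ∧ ω (i + 1) = q} =
        ENNReal.ofReal (P (w i) q) * μ {ω | ∀ j ≤ i, ω j = w j})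
    {E : Type*} [NormedAddCommGroup E] [NormedSpace ℝ E] [CompleteSpace E] (n : ℕ)
    (G : (Fin (n + 1) → Fin m) → Fin m → E) :
    ∫ ω, G (fun j => ω j) (ω (n + 1)) ∂μ = ∫ ω, ∑ q, P (ω n) q • G (fun j => ω j) q ∂μ := by
  let r : (ℕ → Fin m) → (Fin (n + 1) → Fin m) := fun ω j => ω j
  have hr : Measurable r := by fun_prop
  have hrq : Measurable fun ω : ℕ → Fin m => (r ω, ω (n + 1)) := by fun_prop
  have hfib (x : Fin (n + 1) → Fin m) : ∃ w : ℕ → Fin m, w n = x (Fin.last n) ∧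
      ∀ ω, r ω = x ↔ ∀ j ≤ n, ω j = w j := by
    refine ⟨fun j => x ⟨min j n, by omega⟩, by simp [Fin.last], fun ω => ?_⟩
    constructor
    · rintro rfl j hj
      simp [r, hj]
    · intro h
      ext1 j
      have := h j (by omega)
      simp only [r, this]
      congr 1
      ext
      simp; omega
  have hstep (x : Fin (n + 1) → Fin m) (q : Fin m) :
      (μ.map fun ω => (r ω, ω (n + 1))).real {(x, q)} =
        P (x (Fin.last n)) q * (μ.map r).real {x} := by
    obtain ⟨w, hw, hwx⟩ := hfib x
    rw [map_measureReal_apply hrq (by measurability),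
      map_measureReal_apply hr (by measurability), measureReal_def, measureReal_def]
    have h1 : (fun ω : ℕ → Fin m => (r ω, ω (n + 1))) ⁻¹' {(x, q)} =
        {ω | (∀ j ≤ n, ω j = w j) ∧ ω (n + 1) = q} := by
      ext ω; simp [← hwx]
    have h2 : r ⁻¹' {x} = {ω | ∀ j ≤ n, ω j = w j} := by ext ω; simp [← hwx]
    rw [h1, h2, hMarkov, ENNReal.toReal_mul, hw, ENNReal.toReal_ofReal (hpos _ _).le]
  have := Measure.isProbabilityMeasure_map (μ := μ) hr.aemeasurable
  have := Measure.isProbabilityMeasure_map (μ := μ) hrq.aemeasurable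
  calc
    _ = ∫ z, G z.1 z.2 ∂(μ.map fun ω => (r ω, ω (n + 1))) := by
      rw [integral_map hrq.aemeasurable .of_discrete]
    _ = ∑ x, ∑ q, (P (x (Fin.last n)) q * (μ.map r).real {x}) • G x q := by
      rw [integral_fintype .of_finite, Fintype.sum_prod_type]
      simp_rw [hstep]
    _ = ∫ x, ∑ q, P (x (Fin.last n)) q • G x q ∂(μ.map r) := by
      rw [integral_fintype .of_finite]
      simp_rw [Finset.smul_sum, smul_smul, mul_comm]
    _ = _ := by
      rw [integral_map hr.aemeasurable .of_discrete]
      simp [r]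

open Asymptotics Topology Complex in
/-- Second order Taylor expansion of `θ ↦ exp (θ * z)` at `0`. -/
lemma isLittleO_cexp_mul_sub (z : ℂ) :
    (fun θ : ℝ => cexp (θ * z) - (1 + θ * z + (θ * z) ^ 2 / 2)) =o[𝓝 0]
      (fun θ : ℝ => θ ^ 2) := by
  have hz : Tendsto (fun θ : ℝ => (θ : ℂ) * z) (𝓝 0) (𝓝 0) := by
    have : Continuous fun θ : ℝ => (θ : ℂ) * z := by fun_prop
    simpa using this.tendsto 0
  have h := (exp_sub_sum_range_succ_isLittleO_pow 2).comp_tendsto hz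
  refine (h.congr_left fun θ => ?_).trans_isBigO (.of_bound (‖z‖ ^ 2) (.of_forall fun θ => ?_))
  · simp [Finset.sum_range_succ]
  · simp [mul_pow, mul_comm]

open Asymptotics Topology Complex in
/-- If `g` is centred for the transition matrix `P` and `u` solves the Poisson equation of its
conditional variance, then `1 + θ² u` is an eigenvector, up to `o(θ²)`, of the matrix `P` twisted
by `exp (i θ g)`. -/
lemma isLittleO_twisted_transition {m : ℕ} {P : Matrix (Fin m) (Fin m) ℝ}
    {g : Fin m → Fin m → ℝ} {u : Fin m → ℝ} {v : ℝ} {p : Fin m}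
    (hrow : ∑ q, P p q = 1) (hg : ∑ q, P p q * g p q = 0)
    (hu : u p - ∑ q, P p q * u q = (v - ∑ q, P p q * g p q ^ 2) / 2) :
    (fun θ : ℝ => ∑ q, (P p q : ℂ) * (cexp (θ * (g p q * I)) * (1 + θ ^ 2 * u q)) -
      cexp (-(θ ^ 2 * v / 2)) * (1 + θ ^ 2 * u p)) =o[𝓝 0] (fun θ : ℝ => θ ^ 2) := by
  have hone (c : ℝ) : (fun θ : ℝ => (1 + θ ^ 2 * c : ℂ)) =O[𝓝 0] (fun _ => (1 : ℝ)) := by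
    have : Continuous fun θ : ℝ => (1 + θ ^ 2 * c : ℂ) := by fun_prop
    exact (this.tendsto 0).isBigO_one ℝ
  have hcont {F : ℝ → ℂ} (hF : Continuous F) (h0 : F 0 = 0) :
      (fun θ : ℝ => (θ : ℂ) ^ 2 * F θ) =o[𝓝 0] (fun θ : ℝ => θ ^ 2) := by
    have h1 : F =o[𝓝 0] (fun _ => (1 : ℝ)) := by
      rw [isLittleO_one_iff, ← h0]
      exact hF.tendsto 0
    have h2 : (fun θ : ℝ => (θ : ℂ) ^ 2) =O[𝓝 0] (fun θ : ℝ => θ ^ 2) :=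
      .of_bound 1 (.of_forall fun θ => by simp)
    simpa using h2.mul_isLittleO h1
  have hT (q : Fin m) : (fun θ : ℝ => (P p q : ℂ) *
      ((cexp (θ * (g p q * I)) - (1 + θ * (g p q * I) + (θ * (g p q * I)) ^ 2 / 2)) *
        (1 + θ ^ 2 * u q))) =o[𝓝 0] (fun θ : ℝ => θ ^ 2) := by
    have := (isLittleO_cexp_mul_sub (g p q * I)).mul_isBigO (hone (u q))
    simpa using this.const_mul_left (P p q : ℂ)
  have hexp : (fun θ : ℝ => (cexp (-(θ ^ 2 * v / 2)) - (1 - θ ^ 2 * v / 2)) *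
      (1 + θ ^ 2 * u p)) =o[𝓝 0] (fun θ : ℝ => θ ^ 2) := by
    have hz : Tendsto (fun θ : ℝ => (-(θ ^ 2 * v / 2) : ℂ)) (𝓝 0) (𝓝 0) := by
      have : Continuous fun θ : ℝ => (-(θ ^ 2 * v / 2) : ℂ) := by fun_prop
      simpa using this.tendsto 0
    have h := (exp_sub_sum_range_succ_isLittleO_pow 1).comp_tendsto hz
    have h' : (fun θ : ℝ => cexp (-(θ ^ 2 * v / 2)) - (1 - θ ^ 2 * v / 2)) =o[𝓝 0]
        (fun θ : ℝ => θ ^ 2) := by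
      refine (h.congr_left fun θ => ?_).trans_isBigO
        (.of_bound (|v| / 2) (.of_forall fun θ => ?_))
      · simp [Finset.sum_range_succ, sub_eq_add_neg]
      · simp; apply le_of_eq; ring
    simpa using h'.mul_isBigO (hone (u p))
  have hrest := hcont (F := fun θ : ℝ => ∑ q, (P p q : ℂ) *
      ((θ * (g p q * I) + (θ * (g p q * I)) ^ 2 / 2) * u q) + θ ^ 2 * (v * u p / 2))
    (by fun_prop) (by simp)
  have hrow' : ∑ q, (P p q : ℂ) = 1 := mod_cast hrow
  have hg' : ∑ q, (P p q : ℂ) * g p q = 0 := mod_cast hg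
  have hu' : (u p : ℂ) - ∑ q, (P p q : ℂ) * u q =
      (v - ∑ q, (P p q : ℂ) * g p q ^ 2) / 2 := by
    have := congrArg (fun x : ℝ => (x : ℂ)) hu
    push_cast at this
    exact this
  refine (((IsLittleO.sum fun q (_ : q ∈ Finset.univ) => hT q).sub hexp).add hrest).congr_left
    fun θ => ?_
  have hsplit : ∑ q, (P p q : ℂ) * (cexp (θ * (g p q * I)) * (1 + θ ^ 2 * u q)) =
      ∑ q, (P p q : ℂ) *
        ((cexp (θ * (g p q * I)) - (1 + θ * (g p q * I) + (θ * (g p q * I)) ^ 2 / 2)) *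
          (1 + θ ^ 2 * u q)) +
      θ ^ 2 * ∑ q, (P p q : ℂ) * ((θ * (g p q * I) + (θ * (g p q * I)) ^ 2 / 2) * u q) +
      (∑ q, (P p q : ℂ) + θ * I * ∑ q, (P p q : ℂ) * g p q
        - θ ^ 2 / 2 * ∑ q, (P p q : ℂ) * g p q ^ 2 + θ ^ 2 * ∑ q, (P p q : ℂ) * u q) := by
    simp_rw [Finset.mul_sum, ← Finset.sum_add_distrib, ← Finset.sum_sub_distrib,
      ← Finset.sum_add_distrib]
    refine Finset.sum_congr rfl fun q _ => ?_
    linear_combination (P p q : ℂ) * θ ^ 2 * g p q ^ 2 / 2 * I_sq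
  rw [hsplit, hrow', hg', Finset.sum_apply]
  linear_combination (θ : ℂ) ^ 2 * hu'

/-- A sequence that is multiplied by `c` at each step, up to an error `ε`. -/
lemma norm_sub_pow_mul_le {a : ℕ → ℂ} {c : ℂ} {ε : ℝ} (hc : ‖c‖ ≤ 1)
    (h : ∀ k, ‖a (k + 1) - c * a k‖ ≤ ε) (k : ℕ) : ‖a k - c ^ k * a 0‖ ≤ k * ε := by
  induction k with
  | zero => simp
  | succ k ih =>
    calc ‖a (k + 1) - c ^ (k + 1) * a 0‖
        = ‖(a (k + 1) - c * a k) + c * (a k - c ^ k * a 0)‖ := by ring_nf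
      _ ≤ ε + 1 * (k * ε) := by
          refine (norm_add_le _ _).trans (add_le_add (h k) ?_)
          rw [norm_mul]
          gcongr
      _ = _ := by push_cast; ring

open Topology Complex in
/-- Convergence of the characteristic functions of the normalized additive functional of a
stationary finite Markov chain, for a functional with zero conditional mean. -/
lemma tendsto_integral_cexp_sum_of_markov {m : ℕ} {μ : Measure (ℕ → Fin m)}
    [IsProbabilityMeasure μ] {T : (ℕ → Fin m) → (ℕ → Fin m)}
    (hT : ∀ ω i, T ω i = ω (i + 1)) (hTμ : MeasurePreserving T μ μ)
    {P : Matrix (Fin m) (Fin m) ℝ} (hpos : ∀ p q, 0 < P p q) (hrow : ∀ p, ∑ q, P p q = 1)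
    (hMarkov : ∀ (i : ℕ) (w : ℕ → Fin m) (q : Fin m),
      μ {ω | (∀ j ≤ i, ω j = w j) ∧ ω (i + 1) = q} =
        ENNReal.ofReal (P (w i) q) * μ {ω | ∀ j ≤ i, ω j = w j})
    {g : Fin m → Fin m → ℝ} (hg : ∀ p, ∑ q, P p q * g p q = 0) :
    Tendsto (fun n : ℕ => ∫ ω, cexp (((n : ℝ) ^ (-(1 : ℝ) / 2) : ℝ) *
        ((∑ i ∈ Finset.range n, g (ω i) (ω (i + 1)) : ℝ) * I)) ∂μ) atTop
      (𝓝 (cexp (-((∫ ω, g (ω 0) (ω 1) ^ 2 ∂μ : ℝ) / 2)))) := by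
  set v : ℝ := ∫ ω, g (ω 0) (ω 1) ^ 2 ∂μ with hv
  have hv0 : 0 ≤ v := integral_nonneg fun ω => sq_nonneg _
  let ρ : Fin m → ℝ := fun p => (μ.map fun ω => ω 0).real {p}
  have hprob : IsProbabilityMeasure (μ.map fun ω : ℕ → Fin m => ω 0) :=
    Measure.isProbabilityMeasure_map (measurable_pi_apply 0).aemeasurable
  have hρint (f : Fin m → ℝ) : ∫ ω, f (ω 0) ∂μ = ∑ p, ρ p * f p := by
    rw [← integral_map (f := f) (φ := fun ω : ℕ → Fin m => ω 0)
      (measurable_pi_apply 0).aemeasurable .of_discrete,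
      integral_fintype .of_finite]
    rfl
  have hstep0 (f : Fin m → Fin m → ℝ) :
      ∫ ω, f (ω 0) (ω 1) ∂μ = ∑ p, ρ p * ∑ q, P p q * f p q := by
    rw [← hρint fun p => ∑ q, P p q * f p q]
    exact integral_markov_step hpos hMarkov 0 fun x q => f (x 0) q
  have hρ1 : ∑ p, ρ p = 1 := by simpa using (hρint fun _ => 1).symm
  have hstat (q : Fin m) : ∑ p, ρ p * P p q = ρ q := by
    have h1 := hstep0 fun _ q' => if q' = q then 1 else 0
    have h2 := hρint fun q' => if q' = q then 1 else 0
    have h3 : ∫ ω : ℕ → Fin m, (if ω 1 = q then (1 : ℝ) else 0) ∂μ =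
        ∫ ω, (if ω 0 = q then (1 : ℝ) else 0) ∂μ := by
      have hf : Measurable fun ω : ℕ → Fin m => if ω 0 = q then (1 : ℝ) else 0 :=
        (Measurable.of_discrete (f := fun p => if p = q then (1 : ℝ) else 0)).comp
          (measurable_pi_apply 0)
      have := integral_map (μ := μ) hTμ.measurable.aemeasurable hf.aestronglyMeasurable
      rw [hTμ.map_eq] at this
      simpa [hT] using this.symm
    simp only [mul_ite, mul_one, mul_zero, Finset.sum_ite_eq', Finset.mem_univ, if_true] at h1 h2
    rw [← h1, ← h2, h3]
  obtain ⟨u, hu⟩ := exists_poisson_solution hpos hrow hρ1 hstat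
    (f := fun p => (v - ∑ q, P p q * g p q ^ 2) / 2) (by
      simp_rw [← mul_div_assoc, mul_sub, ← Finset.sum_div, Finset.sum_sub_distrib,
        ← Finset.sum_mul, hρ1]
      rw [← hstep0 fun p q => g p q ^ 2, ← hv]
      ring)
  let D : Fin m → ℝ → ℂ := fun p θ =>
    ∑ q, (P p q : ℂ) * (cexp (θ * (g p q * I)) * (1 + θ ^ 2 * u q)) -
      cexp (-(θ ^ 2 * v / 2)) * (1 + θ ^ 2 * u p)
  let S : ℕ → (ℕ → Fin m) → ℝ := fun n ω => ∑ i ∈ Finset.range n, g (ω i) (ω (i + 1))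
  have hSm (n : ℕ) : Measurable (S n) := by
    refine Finset.measurable_sum _ fun i _ => ?_
    exact (Measurable.of_discrete (f := fun z : Fin m × Fin m => g z.1 z.2)).comp
      (f := fun ω : ℕ → Fin m => (ω i, ω (i + 1))) (by fun_prop)
  have hum (n : ℕ) : Measurable fun ω : ℕ → Fin m => u (ω n) :=
    (Measurable.of_discrete (f := u)).comp (measurable_pi_apply n)
  let U : ℝ := ∑ p, |u p|
  have hU (p : Fin m) : |u p| ≤ U :=
    Finset.single_le_sum (f := fun p => |u p|) (fun _ _ => abs_nonneg _) (Finset.mem_univ p)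
  have hnorm (θ x : ℝ) : ‖cexp (θ * (x * I))‖ = 1 := by
    rw [← mul_assoc, ← ofReal_mul, norm_exp_ofReal_mul_I]
  let a : ℝ → ℕ → ℂ := fun θ n => ∫ ω, cexp (θ * (S n ω * I)) * (1 + θ ^ 2 * u (ω n)) ∂μ
  let A : ℝ → ℕ → ℂ := fun θ n => ∫ ω, cexp (θ * (S n ω * I)) ∂μ
  have hint1 (θ : ℝ) (n : ℕ) : Integrable (fun ω => cexp (θ * (S n ω * I))) μ :=
    .of_bound (Measurable.aestronglyMeasurable (by fun_prop)) 1
      (.of_forall fun ω => (hnorm θ _).le)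
  have hint2 (θ : ℝ) (n : ℕ) (f : Fin m → ℂ) :
      Integrable (fun ω => cexp (θ * (S n ω * I)) * f (ω n)) μ := by
    refine .of_bound (Measurable.aestronglyMeasurable ?_) (∑ p, ‖f p‖)
      (.of_forall fun ω => ?_)
    · have : Measurable fun ω : ℕ → Fin m => f (ω n) :=
        (Measurable.of_discrete (f := f)).comp (measurable_pi_apply n)
      fun_prop
    · rw [norm_mul, hnorm, one_mul]
      exact Finset.single_le_sum (f := fun p => ‖f p‖) (fun _ _ => norm_nonneg _)
        (Finset.mem_univ _)
  have hbound {F : (ℕ → Fin m) → ℂ} {C : ℝ} (hF : ∀ ω, ‖F ω‖ ≤ C) : ‖∫ ω, F ω ∂μ‖ ≤ C := by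
    simpa using norm_integral_le_of_norm_le_const (μ := μ) (.of_forall hF)
  have hrec (θ : ℝ) (n : ℕ) :
      a θ (n + 1) - cexp (-(θ ^ 2 * v / 2)) * a θ n =
        ∫ ω, cexp (θ * (S n ω * I)) * D (ω n) θ ∂μ := by
    have h1 : a θ (n + 1) = ∫ ω, cexp (θ * (S n ω * I)) *
        ∑ q, (P (ω n) q : ℂ) * (cexp (θ * (g (ω n) q * I)) * (1 + θ ^ 2 * u q)) ∂μ := by
      have := integral_markov_step hpos hMarkov n fun x q =>
        cexp (θ * ((∑ i : Fin n, g (x i.castSucc) (x i.succ) : ℝ) * I)) *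
          (cexp (θ * (g (x (Fin.last n)) q * I)) * (1 + θ ^ 2 * u q))
      have hS (ω : ℕ → Fin m) : ∑ i : Fin n, g (ω i) (ω (i + 1)) = S n ω :=
        Fin.sum_univ_eq_sum_range (fun i => g (ω i) (ω (i + 1))) n
      simp only [Fin.val_castSucc, Fin.val_succ, Fin.val_last, hS] at this
      convert this using 3 with ω ω
      · simp only [S, Finset.sum_range_succ, ofReal_add, add_mul, mul_add, Complex.exp_add]
        ring
      · rw [Finset.mul_sum]
        refine Finset.sum_congr rfl fun q _ => ?_
        rw [real_smul]
        ring
    rw [h1, ← integral_const_mul, ← integral_sub]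
    · congr 1
      ext ω
      simp only [D]
      ring
    · exact hint2 θ n fun p =>
        ∑ q, (P p q : ℂ) * (cexp (θ * (g p q * I)) * (1 + θ ^ 2 * u q))
    · exact (hint2 θ n fun p => 1 + θ ^ 2 * u p).const_mul _
  have hcorr (θ : ℝ) (n : ℕ) : ‖A θ n - a θ n‖ ≤ θ ^ 2 * U := by
    rw [← integral_sub (hint1 θ n) (hint2 θ n fun p => 1 + θ ^ 2 * u p)]
    refine hbound fun ω => ?_
    rw [show cexp (θ * (S n ω * I)) - cexp (θ * (S n ω * I)) * (1 + θ ^ 2 * u (ω n)) =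
      -(cexp (θ * (S n ω * I)) * (θ ^ 2 * u (ω n))) by ring, norm_neg, norm_mul, hnorm]
    simpa using mul_le_mul_of_nonneg_left (hU (ω n)) (sq_nonneg θ)
  have hA0 (θ : ℝ) : A θ 0 = 1 := by simp [A, S]
  have hlam (θ : ℝ) : ‖cexp (-(θ ^ 2 * v / 2))‖ ≤ 1 := by
    rw [show (-(θ ^ 2 * v / 2) : ℂ) = ((-(θ ^ 2 * v / 2) : ℝ) : ℂ) by push_cast; rfl,
      norm_exp_ofReal, Real.exp_le_one_iff]
    have := mul_nonneg (sq_nonneg θ) hv0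
    linarith
  have hmain (θ : ℝ) (n : ℕ) : ‖A θ n - cexp (-(θ ^ 2 * v / 2)) ^ n‖ ≤
      n * ∑ p, ‖D p θ‖ + 2 * (θ ^ 2 * U) := by
    have h1 := norm_sub_pow_mul_le (a := a θ) (hlam θ) (ε := ∑ p, ‖D p θ‖) (fun k => by
      rw [hrec]
      refine hbound fun ω => ?_
      rw [norm_mul, hnorm, one_mul]
      exact Finset.single_le_sum (f := fun p => ‖D p θ‖) (fun _ _ => norm_nonneg _)
        (Finset.mem_univ _)) n
    have h2 := hcorr θ n
    have h3 : ‖cexp (-(θ ^ 2 * v / 2)) ^ n * (A θ 0 - a θ 0)‖ ≤ 1 * (θ ^ 2 * U) := by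
      rw [norm_mul, norm_pow]
      exact mul_le_mul (pow_le_one₀ (norm_nonneg _) (hlam θ)) (hcorr θ 0) (norm_nonneg _)
        zero_le_one
    rw [hA0] at h3
    calc _ = ‖(A θ n - a θ n) + (a θ n - cexp (-(θ ^ 2 * v / 2)) ^ n * a θ 0) -
          cexp (-(θ ^ 2 * v / 2)) ^ n * (1 - a θ 0)‖ := by ring_nf
      _ ≤ _ := (norm_sub_le _ _).trans (add_le_add_left (norm_add_le _ _) _)
      _ ≤ _ := by linarith
  let θ : ℕ → ℝ := fun n => (n : ℝ) ^ (-(1 : ℝ) / 2)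
  have hθsq (n : ℕ) : θ n ^ 2 = (n : ℝ)⁻¹ := by
    rw [← Real.rpow_natCast, ← Real.rpow_mul n.cast_nonneg, ← Real.rpow_neg_one]
    norm_num
  have hθ : Tendsto θ atTop (𝓝 0) := by
    have := (tendsto_rpow_neg_atTop (y := 1 / 2) (by norm_num)).comp
      (tendsto_natCast_atTop_atTop (R := ℝ))
    simpa [θ, Function.comp_def, neg_div] using this
  have hDlim : Tendsto (fun n : ℕ => n * ∑ p, ‖D p (θ n)‖ + 2 * (θ n ^ 2 * U)) atTop (𝓝 0) := by
    have h1 (p : Fin m) : Tendsto (fun n : ℕ => ‖D p (θ n)‖ / θ n ^ 2) atTop (𝓝 0) :=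
      ((isLittleO_twisted_transition (hrow p) (hg p) (hu p)).comp_tendsto
        hθ).norm_left.tendsto_div_nhds_zero
    have h2 := (tendsto_finsetSum Finset.univ fun p _ => h1 p).add
      (((hθ.pow 2).mul_const U).const_mul 2)
    simp only [Finset.sum_const_zero, ne_eq, OfNat.ofNat_ne_zero, not_false_eq_true, zero_pow,
      zero_mul, mul_zero, add_zero] at h2
    refine h2.congr fun n => ?_
    simp_rw [hθsq, div_inv_eq_mul, Finset.mul_sum, mul_comm]
  rw [tendsto_iff_norm_sub_tendsto_zero]
  refine squeeze_zero' (.of_forall fun _ => norm_nonneg _) ?_ hDlim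
  filter_upwards [eventually_ge_atTop 1] with n hn
  have hpow : cexp (-((θ n : ℂ) ^ 2 * v / 2)) ^ n = cexp (-(v / 2)) := by
    rw [← Complex.exp_nat_mul, ← ofReal_pow, hθsq]
    congr 1
    have : (n : ℂ) ≠ 0 := by exact_mod_cast (by omega : n ≠ 0)
    push_cast
    field_simp
  rw [← hpow]
  exact hmain (θ n) n

/-- The centred multivariate Gaussian law has centred Gaussian one-dimensional projections. -/
lemma map_sum_multivariateGaussian {ι : Type*} [Fintype ι] [DecidableEq ι] {S : Matrix ι ι ℝ}
    (hS : S.PosSemidef) (L : ι → ℝ) :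
    (multivariateGaussian 0 S).map (fun x => ∑ i, L i * x i) =
      gaussianReal 0 (Real.toNNReal (∑ i, ∑ j, L i * S i j * L j)) := by
  have hquad : ∑ i, ∑ j, L i * S i j * L j = L ⬝ᵥ S *ᵥ L := by
    simp [dotProduct, mulVec, Finset.mul_sum, mul_assoc]
  have hmeas : Measurable fun x : EuclideanSpace ℝ ι => ∑ i, L i * x i := by fun_prop
  have := Measure.isProbabilityMeasure_map (μ := multivariateGaussian 0 S) hmeas.aemeasurable
  refine Measure.ext_of_charFun (funext fun t => ?_)
  have hnonneg : 0 ≤ L ⬝ᵥ S *ᵥ L := by simpa using hS.dotProduct_mulVec_nonneg L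
  calc
    _ = charFun (multivariateGaussian 0 S) (WithLp.toLp 2 (t • L)) := by
      rw [charFun_apply_real, charFun_apply, integral_map hmeas.aemeasurable (by fun_prop)]
      congr 1
      ext x
      simp only [PiLp.inner_apply, Pi.smul_apply, smul_eq_mul, RCLike.inner_apply, conj_trivial,
        mul_assoc, ← Finset.mul_sum]
      push_cast
      ring_nf
    _ = _ := by
      rw [charFun_multivariateGaussian hS, charFun_gaussianReal, hquad,
        Real.coe_toNNReal _ hnonneg]
      simp only [inner_zero_right, mulVec_smul, dotProduct_smul, smul_dotProduct,
        smul_eq_mul]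
      push_cast
      ring_nf

/-- **CLT for the score of a stationary ergodic Markov chain.** Let `μ` be
a shift-invariant ergodic measure on `Ω = ℕ → {1,…,m}` that is Markov with strictly
positive row-stochastic transition matrix `P₀`. Let the matrix-valued score vectors be
`V_i(p,q) = 1{X_{i−1}=p, X_i=q}/P₀(p,q) − 1{X_{i−1}=p}` and let
`Σ = E_μ[V₁ V₁ᵀ]`. Then the law of `n^{−1/2} Σ_{i=1}^n V_i` converges weakly to the
centered Gaussian measure on `ℝ^{m×m}` with covariance `Σ`, characterized by the fact
that each of its one-dimensional linear projections is the corresponding centered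
real Gaussian. -/
theorem score_clt (m : ℕ) (hm : 1 ≤ m)
    (μ : Measure (ℕ → Fin m)) [IsProbabilityMeasure μ]
    (T : (ℕ → Fin m) → (ℕ → Fin m)) (hT : ∀ ω i, T ω i = ω (i + 1))
    (hErg : Ergodic T μ)
    (P₀ : Matrix (Fin m) (Fin m) ℝ)
    (hpos : ∀ p q : Fin m, 0 < P₀ p q)
    (hrow : ∀ p : Fin m, ∑ q : Fin m, P₀ p q = 1)
    (hMarkov : ∀ (i : ℕ) (w : ℕ → Fin m) (q : Fin m),
      μ {ω | (∀ j ≤ i, ω j = w j) ∧ ω (i + 1) = q} =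
        ENNReal.ofReal (P₀ (w i) q) * μ {ω | ∀ j ≤ i, ω j = w j})
    (V : ℕ → (ℕ → Fin m) → (Fin m → Fin m → ℝ))
    (hV : ∀ i ω p q, V i ω p q =
      (if ω (i - 1) = p ∧ ω i = q then 1 else 0) / P₀ p q -
        (if ω (i - 1) = p then 1 else 0))
    (Scov : (Fin m × Fin m) → (Fin m × Fin m) → ℝ)
    (hScov : ∀ a b : Fin m × Fin m,
      Scov a b = ∫ ω, V 1 ω a.1 a.2 * V 1 ω b.1 b.2 ∂μ) :
    ∃ γ : Measure (Fin m → Fin m → ℝ), IsProbabilityMeasure γ ∧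
      (∀ L : Fin m → Fin m → ℝ,
        γ.map (fun M => ∑ p : Fin m, ∑ q : Fin m, L p q * M p q) =
          gaussianReal 0
            (Real.toNNReal (∑ s : Fin m × Fin m, ∑ t : Fin m × Fin m,
              L s.1 s.2 * Scov s t * L t.1 t.2))) ∧
      (∀ f : BoundedContinuousFunction (Fin m → Fin m → ℝ) ℝ,
        Tendsto
          (fun n : ℕ => ∫ ω,
            f (((n : ℝ) ^ (-(1 : ℝ) / 2)) • ∑ i ∈ Finset.Icc 1 n, V i ω) ∂μ)
          atTop (nhds (∫ x, f x ∂γ))) := by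
  let S : Matrix (Fin m × Fin m) (Fin m × Fin m) ℝ := Matrix.of Scov
  let g : (Fin m × Fin m → ℝ) → Fin m → Fin m → ℝ := fun L p q =>
    ∑ a, L a * ((if p = a.1 ∧ q = a.2 then 1 else 0) / P₀ a.1 a.2 - (if p = a.1 then 1 else 0))
  have hVm (i : ℕ) (p q : Fin m) : Measurable fun ω => V i ω p q := by
    simp_rw [hV]
    exact (Measurable.of_discrete (f := fun z : Fin m × Fin m =>
      (if z.1 = p ∧ z.2 = q then (1 : ℝ) else 0) / P₀ p q - (if z.1 = p then 1 else 0))).comp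
      (f := fun ω : ℕ → Fin m => (ω (i - 1), ω i)) (by fun_prop)
  have hgV (L : Fin m × Fin m → ℝ) (i : ℕ) (ω : ℕ → Fin m) :
      g L (ω i) (ω (i + 1)) = ∑ a, L a * V (i + 1) ω a.1 a.2 := by simp [g, hV]
  have hg (L : Fin m × Fin m → ℝ) (p : Fin m) : ∑ q, P₀ p q * g L p q = 0 := by
    simp_rw [g, Finset.mul_sum]
    rw [Finset.sum_comm]
    refine Finset.sum_eq_zero fun a _ => ?_
    simp_rw [mul_left_comm _ (L a), ← Finset.mul_sum, mul_sub, Finset.sum_sub_distrib,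
      ← Finset.sum_mul, hrow, one_mul]
    by_cases hp : p = a.1
    · simp [hp, ite_div, (hpos a.1 a.2).ne']
    · simp [hp]
  have hVint (a b : Fin m × Fin m) :
      Integrable (fun ω => V 1 ω a.1 a.2 * V 1 ω b.1 b.2) μ := by
    have hbd (a : Fin m × Fin m) (ω : ℕ → Fin m) : ‖V 1 ω a.1 a.2‖ ≤ (P₀ a.1 a.2)⁻¹ + 1 := by
      have := inv_pos.2 (hpos a.1 a.2)
      rw [hV]
      refine (norm_sub_le _ _).trans (add_le_add ?_ ?_)
      · split_ifs <;> simp [abs_of_pos (hpos a.1 a.2), this.le]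
      · split_ifs <;> simp
    refine .of_bound ((hVm 1 _ _).mul (hVm 1 _ _)).aestronglyMeasurable
      (((P₀ a.1 a.2)⁻¹ + 1) * ((P₀ b.1 b.2)⁻¹ + 1)) (.of_forall fun ω => ?_)
    rw [norm_mul]
    exact mul_le_mul (hbd a ω) (hbd b ω) (norm_nonneg _) ((norm_nonneg _).trans (hbd a ω))
  have hquad (L : Fin m × Fin m → ℝ) :
      ∫ ω, g L (ω 0) (ω 1) ^ 2 ∂μ = ∑ s, ∑ t, L s * Scov s t * L t := by
    have hexp (ω : ℕ → Fin m) : g L (ω 0) (ω 1) ^ 2 =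
        ∑ s, ∑ t, L s * L t * (V 1 ω s.1 s.2 * V 1 ω t.1 t.2) := by
      rw [hgV L 0 ω, sq, Finset.sum_mul_sum]
      refine Finset.sum_congr rfl fun s _ => Finset.sum_congr rfl fun t _ => ?_
      rw [zero_add]
      ring
    simp_rw [hexp]
    rw [integral_finsetSum _ fun s _ => integrable_finsetSum _ fun t _ => (hVint s t).const_mul _]
    refine Finset.sum_congr rfl fun s _ => ?_
    rw [integral_finsetSum _ fun t _ => (hVint s t).const_mul _]
    refine Finset.sum_congr rfl fun t _ => ?_
    rw [integral_const_mul, ← hScov]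
    ring
  have hquad' (L : Fin m × Fin m → ℝ) : L ⬝ᵥ S *ᵥ L = ∑ s, ∑ t, L s * Scov s t * L t := by
    simp [S, dotProduct, mulVec, Finset.mul_sum, mul_assoc]
  have hS : S.PosSemidef := by
    refine .of_dotProduct_mulVec_nonneg ?_ fun L => ?_
    · ext a b
      simp [S, hScov, mul_comm]
    · rw [star_trivial, hquad', ← hquad]
      exact integral_nonneg fun ω => sq_nonneg _
  let e : EuclideanSpace ℝ (Fin m × Fin m) → (Fin m → Fin m → ℝ) := fun x p q => x (p, q)
  have he : Continuous e := by fun_prop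
  let X : ℕ → (ℕ → Fin m) → EuclideanSpace ℝ (Fin m × Fin m) := fun n ω =>
    WithLp.toLp 2 fun a => (n : ℝ) ^ (-(1 : ℝ) / 2) * ∑ i ∈ Finset.range n, V (i + 1) ω a.1 a.2
  have hX (n : ℕ) : Measurable (X n) := by
    have h (a : Fin m × Fin m) : Measurable fun ω =>
        (n : ℝ) ^ (-(1 : ℝ) / 2) * ∑ i ∈ Finset.range n, V (i + 1) ω a.1 a.2 :=
      (Finset.measurable_sum _ fun i _ => hVm _ _ _).const_mul _
    exact (WithLp.measurable_toLp 2 _).comp (measurable_pi_lambda _ h)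
  have heX (n : ℕ) (ω : ℕ → Fin m) :
      e (X n ω) = ((n : ℝ) ^ (-(1 : ℝ) / 2)) • ∑ i ∈ Finset.Icc 1 n, V i ω := by
    ext p q
    have : ∑ i ∈ Finset.Icc 1 n, V i ω = ∑ i ∈ Finset.range n, V (i + 1) ω := by
      rw [Finset.range_eq_Ico, Finset.sum_Ico_add' (fun i => V i ω) 0 n 1]
      rfl
    simp [e, X, this, Finset.sum_apply]
  have hprob (n : ℕ) : IsProbabilityMeasure (μ.map (X n)) :=
    Measure.isProbabilityMeasure_map (hX n).aemeasurable
  let ν : ℕ → ProbabilityMeasure (EuclideanSpace ℝ (Fin m × Fin m)) :=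
    fun n => ⟨μ.map (X n), hprob n⟩
  let γ₀ : ProbabilityMeasure (EuclideanSpace ℝ (Fin m × Fin m)) :=
    ⟨multivariateGaussian 0 S, inferInstance⟩
  have hlim : Tendsto ν atTop (nhds γ₀) := by
    refine ProbabilityMeasure.tendsto_of_tendsto_charFun fun t => ?_
    have h := tendsto_integral_cexp_sum_of_markov hT hErg.toMeasurePreserving hpos hrow hMarkov
      (hg t)
    have hlimit : charFun (γ₀ : Measure _) t =
        Complex.exp (-((∫ ω, g t (ω 0) (ω 1) ^ 2 ∂μ : ℝ) / 2)) := by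
      change charFun (multivariateGaussian 0 S) t = _
      rw [charFun_multivariateGaussian hS, hquad', hquad]
      simp
    rw [hlimit]
    refine h.congr fun n => ?_
    change _ = charFun (μ.map (X n)) t
    rw [charFun_apply, integral_map (hX n).aemeasurable (by fun_prop)]
    congr 1
    ext ω
    have hinner : inner ℝ (X n ω) t = (n : ℝ) ^ (-(1 : ℝ) / 2) *
        ∑ i ∈ Finset.range n, g t (ω i) (ω (i + 1)) := by
      simp_rw [hgV]
      rw [Finset.sum_comm]
      simp only [X, PiLp.inner_apply, RCLike.inner_apply, conj_trivial, Finset.mul_sum]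
      refine Finset.sum_congr rfl fun a _ => Finset.sum_congr rfl fun i _ => ?_
      ring
    rw [hinner]
    push_cast
    ring_nf
  refine ⟨(multivariateGaussian 0 S).map e,
    Measure.isProbabilityMeasure_map he.measurable.aemeasurable, fun L => ?_, fun f => ?_⟩
  · rw [Measure.map_map (by fun_prop) he.measurable]
    have := map_sum_multivariateGaussian hS fun a => L a.1 a.2
    simpa [Function.comp_def, e, S, Fintype.sum_prod_type] using this
  · have h := ProbabilityMeasure.tendsto_iff_forall_integral_tendsto.1 hlim
      (f.compContinuous ⟨e, he⟩)
    rw [integral_map he.measurable.aemeasurable (by fun_prop)]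
    refine h.congr fun n => ?_
    change ∫ x, f (e x) ∂(μ.map (X n)) = _
    rw [integral_map (hX n).aemeasurable (by fun_prop)]
    simp_rw [heX]
end

section
/- Let m ≥ 1, let Ω = ℕ → {1,…,m} with the product σ-algebra and coordinate maps X_i(ω) = ω(i), let T : Ω → Ω be the left shift (Tω)(i) = ω(i+1), and let μ be a T-invariant ergodic probability measure on Ω. Fix c ∈ (0,1) and let 𝒫 be the set of m×m row-stochastic matrices P with P(p,q) ≥ c/m for all p,q. Define f_n(ω) = sup_{P ∈ 𝒫} | (1/n) Σ_{i=1}^n log P(ω(i−1), ω(i)) − ∫_Ω log P(ω'(0), ω'(1)) dμ(ω') |. Then f_n → 0 in μ-probability as n → ∞ (i.e., for every δ > 0, μ({ω : f_n(ω) > δ}) → 0). -/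
open MeasureTheory Matrix Finset Filter

open scoped Topology

section MeanErgodic

variable {α : Type*} [MeasurableSpace α] {μ : Measure α} {T : α → α}

theorem MeasureTheory.MeasurePreserving.birkhoffAverage_toLp_ae_eq (hT : MeasurePreserving T μ μ)
    {g : α → ℝ} (hg : MemLp g 2 μ) (n : ℕ) :
    (birkhoffAverage ℝ (Lp.compMeasurePreserving T hT) id n (hg.toLp g) : Lp ℝ 2 μ)
      =ᵐ[μ] birkhoffAverage ℝ T g n := by
  have hsum : (birkhoffSum (Lp.compMeasurePreserving T hT) id n (hg.toLp g) : Lp ℝ 2 μ)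
      =ᵐ[μ] birkhoffSum T g n := by
    induction n with
    | zero =>
      simp only [birkhoffSum_zero]
      exact Lp.coeFn_zero _ _ _
    | succ n ih =>
      rw [birkhoffSum_succ, Lp.compMeasurePreserving_iterate, id, Lp.toLp_compMeasurePreserving]
      filter_upwards [ih, Lp.coeFn_add (birkhoffSum (Lp.compMeasurePreserving T hT) id n
          (hg.toLp g)) ((hg.comp_measurePreserving (hT.iterate n)).toLp _),
        (hg.comp_measurePreserving (hT.iterate n)).coeFn_toLp] with x h₁ h₂ h₃
      rw [h₂, Pi.add_apply, h₁, h₃, birkhoffSum_succ, Function.comp_apply]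
  filter_upwards [hsum, Lp.coeFn_smul (n : ℝ)⁻¹
    (birkhoffSum (Lp.compMeasurePreserving T hT) id n (hg.toLp g))] with x h₁ h₂
  rw [birkhoffAverage, h₂, Pi.smul_apply, h₁, birkhoffAverage]

/-- The **mean ergodic theorem** for an ergodic map of a probability space: the Birkhoff averages
of a square-integrable function converge in measure to its integral. -/
theorem Ergodic.tendstoInMeasure_birkhoffAverage [IsProbabilityMeasure μ] (hT : Ergodic T μ)
    {g : α → ℝ} (hg : MemLp g 2 μ) :
    TendstoInMeasure μ (birkhoffAverage ℝ T g) atTop fun _ ↦ ∫ x, g x ∂μ := by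
  have hmp := hT.toMeasurePreserving
  let U : Lp ℝ 2 μ →L[ℝ] Lp ℝ 2 μ :=
    (Lp.compMeasurePreservingₗᵢ ℝ T hmp).toContinuousLinearMap
  let K : Submodule ℝ (Lp ℝ 2 μ) := U.eqLocus (1 : Lp ℝ 2 μ →L[ℝ] Lp ℝ 2 μ)
  let h : K := K.orthogonalProjectionOnto (hg.toLp g)
  have hlim : Tendsto (fun n ↦ birkhoffAverage ℝ (Lp.compMeasurePreserving T hmp) id n
      (hg.toLp g)) atTop (𝓝 (h : Lp ℝ 2 μ)) :=
    U.tendsto_birkhoffAverage_orthogonalProjection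
      (LinearIsometry.norm_toContinuousLinearMap_le _) (hg.toLp g)
  obtain ⟨a, ha⟩ : ∃ a, (h : Lp ℝ 2 μ) =ᵐ[μ] Function.const α a := by
    refine hT.ae_eq_const_of_ae_eq_comp_ae (Lp.aestronglyMeasurable _) ?_
    have hfix : Lp.compMeasurePreserving T hmp (h : Lp ℝ 2 μ) = h := h.2
    have := Lp.coeFn_compMeasurePreserving (h : Lp ℝ 2 μ) hmp
    rw [hfix] at this
    exact this.symm
  have hone : indicatorConstLp 2 MeasurableSet.univ (measure_ne_top μ _) (1 : ℝ) ∈ K := by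
    change Lp.compMeasurePreserving T hmp _ = _
    rw [Lp.indicatorConstLp_compMeasurePreserving]
    rfl
  have hint : ∫ x, g x ∂μ = a := by
    have := K.inner_orthogonalProjectionOnto_eq_of_mem_left ⟨_, hone⟩ (hg.toLp g)
    rw [Submodule.coe_inner, L2.inner_indicatorConstLp_one, L2.inner_indicatorConstLp_one,
      setIntegral_univ, setIntegral_univ, integral_congr_ae ha,
      integral_congr_ae hg.coeFn_toLp] at this
    simpa using this.symm
  rw [hint]
  exact (tendstoInMeasure_of_tendsto_Lp hlim).congr (hmp.birkhoffAverage_toLp_ae_eq hg) ha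

end MeanErgodic

section FiniteObservable

theorem MeasureTheory.TendstoInMeasure.measure_lt_sum_abs_sub {α ι : Type*} [MeasurableSpace α]
    {μ : Measure α} [Fintype ι] {g : ι → ℕ → α → ℝ} {a : ι → α → ℝ}
    (h : ∀ j, TendstoInMeasure μ (g j) atTop (a j)) {ε : ℝ} (hε : 0 < ε) :
    Tendsto (fun n ↦ μ {x | ε < ∑ j, |g j n x - a j x|}) atTop (𝓝 0) := by
  set η : ℝ := ε / (Fintype.card ι + 1) with hη
  have hη_pos : 0 < η := by positivity
  have hlim : Tendsto (fun n ↦ ∑ j, μ {x | η ≤ ‖g j n x - a j x‖}) atTop (𝓝 0) := by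
    simpa using tendsto_finsetSum Finset.univ fun j _ ↦
      tendstoInMeasure_iff_norm.1 (h j) η hη_pos
  refine tendsto_of_tendsto_of_tendsto_of_le_of_le tendsto_const_nhds hlim (fun _ ↦ zero_le)
    fun n ↦ (measure_mono fun x hx ↦ ?_).trans (measure_iUnion_fintype_le μ _)
  by_contra! hx'
  simp only [Set.mem_iUnion, Set.mem_ofPred_eq, not_exists, not_le, Real.norm_eq_abs] at hx hx'
  have hle : ∑ j, |g j n x - a j x| ≤ Fintype.card ι * η := by
    simpa using Finset.sum_le_sum fun j (_ : j ∈ Finset.univ) ↦ (hx' j).le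
  have hεη : ε = (Fintype.card ι + 1) * η := by rw [hη]; field_simp
  linarith

theorem comp_eq_sum_mul_indicator {α ι : Type*} [Fintype ι] (g : α → ι) (L : ι → ℝ)
    (x : α) : L (g x) = ∑ j, L j * (g ⁻¹' {j}).indicator 1 x := by
  classical
  simp [Set.indicator_apply]

variable {α ι : Type*} [MeasurableSpace α] {μ : Measure α} {T : α → α}
  [Fintype ι] [MeasurableSpace ι] [MeasurableSingletonClass ι]

theorem abs_birkhoffAverage_comp_sub_integral_le [IsFiniteMeasure μ] {g : α → ι}
    (hg : Measurable g) {L : ι → ℝ} {C : ℝ} (hL : ∀ j, |L j| ≤ C) (n : ℕ) (x : α) :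
    |birkhoffAverage ℝ T (fun y ↦ L (g y)) n x - ∫ y, L (g y) ∂μ| ≤
      C * ∑ j, |birkhoffAverage ℝ T ((g ⁻¹' {j}).indicator 1) n x -
        ∫ y, (g ⁻¹' {j}).indicator (1 : α → ℝ) y ∂μ| := by
  have hint (j : ι) : Integrable ((g ⁻¹' {j}).indicator (1 : α → ℝ)) μ :=
    (integrable_const (1 : ℝ)).indicator (hg (measurableSet_singleton j))
  have havg : birkhoffAverage ℝ T (fun y ↦ L (g y)) n x =
      ∑ j, L j * birkhoffAverage ℝ T ((g ⁻¹' {j}).indicator 1) n x := by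
    simp only [birkhoffAverage, birkhoffSum, comp_eq_sum_mul_indicator g L, smul_eq_mul]
    rw [Finset.sum_comm, Finset.mul_sum]
    refine Finset.sum_congr rfl fun j _ ↦ ?_
    rw [← Finset.mul_sum]
    ring
  have hintegral : ∫ y, L (g y) ∂μ =
      ∑ j, L j * ∫ y, (g ⁻¹' {j}).indicator (1 : α → ℝ) y ∂μ := by
    simp only [comp_eq_sum_mul_indicator g L]
    rw [integral_finsetSum _ fun j _ ↦ (hint j).const_mul (L j)]
    simp only [integral_const_mul]
  rw [havg, hintegral, ← Finset.sum_sub_distrib, Finset.mul_sum]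
  refine (Finset.abs_sum_le_sum_abs _ _).trans (Finset.sum_le_sum fun j _ ↦ ?_)
  rw [← mul_sub, abs_mul]
  exact mul_le_mul_of_nonneg_right (hL j) (abs_nonneg _)

/-- Uniform law of large numbers: for an ergodic map and an observable with values in a finite type,
the Birkhoff averages converge in measure uniformly over uniformly bounded functions of the
observable. -/
theorem Ergodic.tendsto_measure_lt_iSup_birkhoffAverage [IsProbabilityMeasure μ]
    (hT : Ergodic T μ) {g : α → ι} (hg : Measurable g) {κ : Sort*} {L : κ → ι → ℝ} {C : ℝ}
    (hL : ∀ k j, |L k j| ≤ C) {δ : ℝ} (hδ : 0 < δ) :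
    Tendsto (fun n ↦ μ {x | δ < ⨆ k, |birkhoffAverage ℝ T (fun y ↦ L k (g y)) n x -
      ∫ y, L k (g y) ∂μ|}) atTop (𝓝 0) := by
  have hC : 0 < |C| + 1 := by positivity
  have hmem (j : ι) : MemLp ((g ⁻¹' {j}).indicator (1 : α → ℝ)) 2 μ :=
    (memLp_const (1 : ℝ)).indicator (hg (measurableSet_singleton j))
  refine tendsto_of_tendsto_of_tendsto_of_le_of_le tendsto_const_nhds
    (TendstoInMeasure.measure_lt_sum_abs_sub
      (fun j ↦ hT.tendstoInMeasure_birkhoffAverage (hmem j)) (div_pos hδ hC))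
    (fun _ ↦ zero_le) fun n ↦ measure_mono fun x hx ↦ ?_
  rw [Set.mem_ofPred_eq, div_lt_iff₀' hC]
  refine lt_of_lt_of_le hx (Real.iSup_le (fun k ↦ ?_) (by positivity))
  exact abs_birkhoffAverage_comp_sub_integral_le hg
    (fun j ↦ (hL k j).trans ((le_abs_self C).trans (lt_add_one _).le)) n x

end FiniteObservable

/-- **uniform law of large numbers for the Markov log-likelihood.** Let
`μ` be a shift-invariant ergodic measure on `Ω = ℕ → {1,…,m}`, `c ∈ (0,1)`, and let `𝒫`
be the set of row-stochastic matrices with all entries at least `c/m`. Define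
`f_n(ω) = sup_{P ∈ 𝒫} | (1/n) Σ_{i=1}^n log P(ω(i−1), ω(i)) − ∫ log P(ω'(0), ω'(1)) dμ |`.
Then `f_n → 0` in `μ`-probability. -/
theorem uniform_lln_loglikelihood (m : ℕ) (hm : 1 ≤ m)
    (c : ℝ) (hc0 : 0 < c) (hc1 : c < 1)
    (μ : Measure (ℕ → Fin m)) [IsProbabilityMeasure μ]
    (T : (ℕ → Fin m) → (ℕ → Fin m)) (hT : ∀ ω i, T ω i = ω (i + 1))
    (hErg : Ergodic T μ)
    (f : ℕ → (ℕ → Fin m) → ℝ)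
    (hf : ∀ n ω, f n ω =
      ⨆ P : {P : Matrix (Fin m) (Fin m) ℝ //
              (∀ p : Fin m, ∑ q : Fin m, (P : Matrix (Fin m) (Fin m) ℝ) p q = 1) ∧
              (∀ p q : Fin m, c / m ≤ (P : Matrix (Fin m) (Fin m) ℝ) p q)},
        |(1 / n : ℝ) * ∑ i ∈ Finset.Icc 1 n,
            Real.log ((P : Matrix (Fin m) (Fin m) ℝ) (ω (i - 1)) (ω i)) -
          ∫ ω', Real.log ((P : Matrix (Fin m) (Fin m) ℝ) (ω' 0) (ω' 1)) ∂μ|) :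
    ∀ δ : ℝ, 0 < δ →
      Tendsto (fun n : ℕ => μ {ω | f n ω > δ}) atTop (nhds 0) := by
  intro δ hδ
  have hm' : (0 : ℝ) < m := by exact_mod_cast hm
  have hcm : 0 < c / m := div_pos hc0 hm'
  have hiter (ω : ℕ → Fin m) (i j : ℕ) : T^[i] ω j = ω (j + i) := by
    induction i generalizing j with
    | zero => rfl
    | succ i ih => rw [Function.iterate_succ_apply', hT, ih]; congr 1; ring
  have hsum (ω : ℕ → Fin m) (n : ℕ) (L : Fin m → Fin m → ℝ) :
      (1 / n : ℝ) * ∑ i ∈ Finset.Icc 1 n, L (ω (i - 1)) (ω i) =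
        birkhoffAverage ℝ T (fun ω' ↦ L (ω' 0) (ω' 1)) n ω := by
    rw [birkhoffAverage, birkhoffSum, smul_eq_mul, one_div, ← Finset.Ico_succ_right_eq_Icc,
      Finset.sum_Ico_eq_sum_range]
    simp [hiter]
  have key := hErg.tendsto_measure_lt_iSup_birkhoffAverage (g := fun ω ↦ (ω 0, ω 1))
    (by fun_prop) (C := -Real.log (c / m))
    (L := fun (P : {P : Matrix (Fin m) (Fin m) ℝ // (∀ p, ∑ q, P p q = 1) ∧ ∀ p q, c / m ≤ P p q})
      (pq : Fin m × Fin m) ↦ Real.log (P.1 pq.1 pq.2)) (fun P pq ↦ ?_) hδ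
  · simpa only [hf, gt_iff_lt, fun ω n (P : Matrix (Fin m) (Fin m) ℝ) ↦ hsum ω n fun p q ↦ Real.log (P p q)] using key
  · obtain ⟨P, hP₁, hP₂⟩ := P
    have hle : P pq.1 pq.2 ≤ 1 := by
      rw [← hP₁ pq.1]
      exact Finset.single_le_sum (f := fun q ↦ P pq.1 q) (fun q _ ↦ hcm.le.trans (hP₂ _ q))
        (Finset.mem_univ _)
    rw [abs_of_nonpos (Real.log_nonpos (hcm.le.trans (hP₂ _ _)) hle)]
    exact neg_le_neg (Real.log_le_log hcm (hP₂ _ _))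
end

section
/- Let m ≥ 1 and let K be a compact set of m×m row-stochastic matrices such that every P ∈ K is primitive: there exists n (depending on P) with all entries of P^n strictly positive. Then for every ε > 0 there exists N ∈ ℕ such that for every P ∈ K, every probability vector μ with μᵀ P = μᵀ, every t ≥ N, and every state p: (1/2) Σ_q | (P^t)(p,q) − μ(q) | ≤ ε. -/
open Matrix Finset

/-- Doeblin contraction: a row-stochastic matrix with all entries at least `δ` contracts the
`ℓ¹` norm of zero-sum row vectors by the factor `1 - δ * card ι`. -/
theorem sum_abs_vecMul_le_of_le {ι : Type*} [Fintype ι] [DecidableEq ι] {Q : Matrix ι ι ℝ}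
    (hQ : Q ∈ rowStochastic ℝ ι) {δ : ℝ} (hδ : ∀ p q, δ ≤ Q p q) {v : ι → ℝ}
    (hv : ∑ p, v p = 0) :
    ∑ q, |(v ᵥ* Q) q| ≤ (1 - Fintype.card ι * δ) * ∑ p, |v p| := by
  have key : ∀ q, |(v ᵥ* Q) q| ≤ ∑ p, |v p| * (Q p q - δ) := fun q => by
    have h : (v ᵥ* Q) q = ∑ p, v p * (Q p q - δ) := by
      simp only [vecMul, dotProduct, mul_sub, sum_sub_distrib, ← sum_mul, hv, zero_mul, sub_zero]
    rw [h]
    refine (abs_sum_le_sum_abs _ _).trans_eq (sum_congr rfl fun p _ => ?_)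
    rw [abs_mul, abs_of_nonneg (sub_nonneg.2 (hδ p q))]
  refine (sum_le_sum fun q _ => key q).trans_eq ?_
  rw [sum_comm, mul_comm, sum_mul]
  refine sum_congr rfl fun p _ => ?_
  rw [← mul_sum, sum_sub_distrib, sum_row_of_mem_rowStochastic hQ p]
  simp

theorem sum_vecMul_of_mem_rowStochastic {ι : Type*} [Fintype ι] [DecidableEq ι]
    {Q : Matrix ι ι ℝ} (hQ : Q ∈ rowStochastic ℝ ι) (v : ι → ℝ) :
    ∑ q, (v ᵥ* Q) q = ∑ p, v p := by
  simp only [vecMul, dotProduct]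
  rw [sum_comm]
  simp [← mul_sum, sum_row_of_mem_rowStochastic hQ]

theorem sum_abs_vecMul_pow_le_of_le {ι : Type*} [Fintype ι] [DecidableEq ι] {Q : Matrix ι ι ℝ}
    (hQ : Q ∈ rowStochastic ℝ ι) {δ : ℝ} (hδ : ∀ p q, δ ≤ Q p q)
    (hc : 0 ≤ 1 - Fintype.card ι * δ) {v : ι → ℝ} (hv : ∑ p, v p = 0) (k : ℕ) :
    ∑ q, |(v ᵥ* Q ^ k) q| ≤ (1 - Fintype.card ι * δ) ^ k * ∑ p, |v p| := by
  induction k with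
  | zero => simp
  | succ k ih =>
    rw [pow_succ Q, ← vecMul_vecMul, pow_succ', mul_assoc]
    have hsum := (sum_vecMul_of_mem_rowStochastic (pow_mem hQ k) v).trans hv
    exact (sum_abs_vecMul_le_of_le hQ hδ hsum).trans (mul_le_mul_of_nonneg_left ih hc)

/-- If `P ^ n` has all entries at least `δ`, the total variation distance of the chain to a
stationary distribution after `t ≥ n * k` steps is at most `(1 - δ * card ι) ^ k`. -/
theorem half_sum_abs_pow_sub_stationary_le {ι : Type*} [Fintype ι] [DecidableEq ι]
    {P : Matrix ι ι ℝ} (hP : P ∈ rowStochastic ℝ ι) {n : ℕ} {δ : ℝ}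
    (hδ : ∀ p q, δ ≤ (P ^ n) p q) (hc : 0 ≤ 1 - Fintype.card ι * δ) {μ : ι → ℝ}
    (hμ0 : ∀ q, 0 ≤ μ q) (hμ1 : ∑ q, μ q = 1) (hμ : μ ᵥ* P = μ) {k t : ℕ} (ht : n * k ≤ t)
    (p : ι) :
    (1 / 2 : ℝ) * ∑ q, |(P ^ t) p q - μ q| ≤ (1 - Fintype.card ι * δ) ^ k := by
  have hstat : ∀ s : ℕ, μ ᵥ* P ^ s = μ := fun s => by
    induction s with
    | zero => simp
    | succ s ih => rw [pow_succ, ← vecMul_vecMul, ih, hμ]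
  set v : ι → ℝ := Pi.single p 1 - μ with hvdef
  have hv : ∑ q, v q = 0 := by simp [hvdef, hμ1]
  have hv2 : ∑ q, |v q| ≤ 2 := by
    calc ∑ q, |v q| ≤ ∑ q, (|(Pi.single p 1 : ι → ℝ) q| + |μ q|) :=
          sum_le_sum fun q _ => abs_sub _ _
      _ = 2 := by
          simp only [sum_add_distrib, abs_of_nonneg (hμ0 _), hμ1, Pi.single_apply]
          simp only [apply_ite abs, abs_one, abs_zero, sum_ite_eq', mem_univ, if_true]
          norm_num
  have hrow : ∀ q, (P ^ t) p q - μ q = (v ᵥ* (P ^ n) ^ k ᵥ* P ^ (t - n * k)) q := fun q => by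
    rw [vecMul_vecMul, ← pow_mul, ← pow_add, Nat.add_sub_cancel' ht, hvdef, sub_vecMul, hstat]
    simp
  have hQ := pow_mem hP n
  have hr := pow_mem hP (t - n * k)
  have h1 := sum_abs_vecMul_le_of_le hr (fun _ _ => nonneg_of_mem_rowStochastic hr)
    ((sum_vecMul_of_mem_rowStochastic (pow_mem hQ k) v).trans hv)
  have h2 := sum_abs_vecMul_pow_le_of_le hQ hδ hc hv k
  have h3 := mul_le_mul_of_nonneg_left hv2 (pow_nonneg hc k)
  simp only [hrow]
  linarith

/-- **uniform mixing over a compact family of primitive stochastic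
matrices.** Let `K` be a compact set of `m × m` row-stochastic matrices each of which is
primitive (some power is entrywise positive). Then for every `ε > 0` there is `N` such
that for all `P ∈ K`, every stationary probability vector `μ` of `P`, every `t ≥ N` and
every state `p`, the total-variation distance `(1/2) Σ_q |Pᵗ(p,q) − μ(q)|` is at most
`ε`. -/
theorem uniform_mixing_of_compact (m : ℕ) (hm : 1 ≤ m)
    (K : Set (Matrix (Fin m) (Fin m) ℝ))
    (hK : IsCompact K)
    (hstoch : ∀ P ∈ K, (∀ p q : Fin m, 0 ≤ P p q) ∧ (∀ p : Fin m, ∑ q : Fin m, P p q = 1))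
    (hprim : ∀ P ∈ K, ∃ n : ℕ, ∀ p q : Fin m, 0 < (P ^ n) p q) :
    ∀ ε : ℝ, 0 < ε → ∃ N : ℕ, ∀ P ∈ K, ∀ μ : Fin m → ℝ,
      ((∀ q, 0 ≤ μ q) ∧ (∑ q : Fin m, μ q = 1) ∧ Matrix.vecMul μ P = μ) →
      ∀ t : ℕ, N ≤ t → ∀ p : Fin m,
        (1 / 2 : ℝ) * ∑ q : Fin m, |(P ^ t) p q - μ q| ≤ ε := by
  intro ε hε
  have hmem : ∀ P ∈ K, P ∈ rowStochastic ℝ (Fin m) := fun P hP =>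
    mem_rowStochastic_iff_sum.2 (hstoch P hP)
  suffices h : ∃ N : ℕ, ∀ P ∈ K, P ∈ K → ∀ μ : Fin m → ℝ,
      ((∀ q, 0 ≤ μ q) ∧ (∑ q : Fin m, μ q = 1) ∧ Matrix.vecMul μ P = μ) →
      ∀ t : ℕ, N ≤ t → ∀ p : Fin m,
        (1 / 2 : ℝ) * ∑ q : Fin m, |(P ^ t) p q - μ q| ≤ ε by
    obtain ⟨N, hN⟩ := h
    exact ⟨N, fun P hP => hN P hP hP⟩
  refine hK.induction_on (p := fun S => ∃ N : ℕ, ∀ P ∈ S, P ∈ K → ∀ μ : Fin m → ℝ,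
      ((∀ q, 0 ≤ μ q) ∧ (∑ q : Fin m, μ q = 1) ∧ Matrix.vecMul μ P = μ) →
      ∀ t : ℕ, N ≤ t → ∀ p : Fin m,
        (1 / 2 : ℝ) * ∑ q : Fin m, |(P ^ t) p q - μ q| ≤ ε) ⟨0, by simp⟩ ?_ ?_ ?_
  · rintro S T hST ⟨N, hN⟩
    exact ⟨N, fun P hP => hN P (hST hP)⟩
  · rintro S T ⟨N, hN⟩ ⟨M, hM⟩
    refine ⟨max N M, fun P hP hPK μ hμ t ht => ?_⟩
    rcases hP with hP | hP
    · exact hN P hP hPK μ hμ t ((le_max_left _ _).trans ht)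
    · exact hM P hP hPK μ hμ t ((le_max_right _ _).trans ht)
  · intro P₀ hP₀
    obtain ⟨n, hn⟩ := hprim P₀ hP₀
    obtain ⟨δ, hδ, hδ0⟩ : ∃ δ : ℝ, (∀ p q, δ < (P₀ ^ n) p q) ∧ 0 < δ := by
      have h : ∀ᶠ δ : ℝ in nhdsWithin 0 (Set.Ioi 0), ∀ p q, δ < (P₀ ^ n) p q :=
        Filter.eventually_all.2 fun p => Filter.eventually_all.2 fun q =>
          nhdsWithin_le_nhds (eventually_lt_nhds (hn p q))
      exact (h.and self_mem_nhdsWithin).exists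
    have hc0 : 0 ≤ 1 - Fintype.card (Fin m) * δ := by
      have h := sum_row_of_mem_rowStochastic (pow_mem (hmem P₀ hP₀) n) ⟨0, hm⟩
      have h' := card_nsmul_le_sum univ (fun q => (P₀ ^ n) ⟨0, hm⟩ q) δ fun q _ => (hδ _ q).le
      rw [h, nsmul_eq_mul, card_univ] at h'
      linarith
    have hc1 : 1 - Fintype.card (Fin m) * δ < 1 := by
      have : (0 : ℝ) < Fintype.card (Fin m) := by
        rw [Fintype.card_fin]
        exact_mod_cast hm
      linarith [mul_pos this hδ0]
    obtain ⟨k, hk⟩ := exists_pow_lt_of_lt_one hε hc1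
    refine ⟨{P | ∀ p q, δ < (P ^ n) p q}, mem_nhdsWithin_of_mem_nhds ?_, n * k, ?_⟩
    · refine Filter.eventually_all.2 fun p => Filter.eventually_all.2 fun q => ?_
      exact ((continuous_pow n).matrix_elem p q).continuousAt.eventually_const_lt (hδ p q)
    · rintro P hP hPK μ ⟨hμ0, hμ1, hμ⟩ t ht p
      exact (half_sum_abs_pow_sub_stationary_le (hmem P hPK) (fun p q => (hP p q).le) hc0 hμ0 hμ1
        hμ ht p).trans hk.le
end
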